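/- (Quartet mechanism) Let V be a finite-dimensional complex inner product space with two anticommuting square-zero operators Q⁺, Q⁻ whose adjoints satisfy [Qᵅ, (Qᵝ)†] = δᵅᵝ Δ (graded commutators), where Δ := Q⁺(Q⁺)† + (Q⁺)†Q⁺. Let V_δ be the δ-eigenspace of Δ for some δ > 0. Then for every nonzero x̃ ∈ V_δ with (Q⁺)† x̃ = 0 and (Q⁻)† x̃ = 0, the four vectors x̃, Q⁺x̃, Q⁻x̃, Q⁻Q⁺x̃ are all nonzero, and ‖Q± x̃‖² = δ ‖x̃‖². -/

import Mathlib

open LinearMap (adjoint)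

/-- If `Q† x = 0` and `x` is an eigenvector of `Q Q† + Q† Q` with eigenvalue `δ`,
then `‖Q x‖² = δ ‖x‖²`. -/
theorem norm_sq_apply_of_adjoint_apply_eq_zero {V : Type*} [NormedAddCommGroup V]
    [InnerProductSpace ℂ V] [FiniteDimensional ℂ V] (Q : V →ₗ[ℂ] V) {δ : ℝ} {x : V}
    (hx : adjoint Q x = 0)
    (heig : (Q ∘ₗ adjoint Q + adjoint Q ∘ₗ Q) x = (δ : ℂ) • x) :
    ‖Q x‖ ^ 2 = δ * ‖x‖ ^ 2 := by
  have h : adjoint Q (Q x) = (δ : ℂ) • x := by simpa [hx] using heig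
  have hinner : inner ℂ (Q x) (Q x) = (δ : ℂ) * inner ℂ x x := by
    rw [← LinearMap.adjoint_inner_right, h, inner_smul_right]
  rw [inner_self_eq_norm_sq_to_K, inner_self_eq_norm_sq_to_K] at hinner
  apply Complex.ofReal_injective
  push_cast
  exact hinner

/-- Quartet mechanism: for a nonzero `x̃` in the `δ`-eigenspace of the Laplacian
(`δ > 0`) annihilated by both `(Q⁺)†` and `(Q⁻)†`, the four vectors
`x̃, Q⁺x̃, Q⁻x̃, Q⁻Q⁺x̃` are all nonzero and `‖Q±x̃‖² = δ‖x̃‖²`. -/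
theorem stmt2 {V : Type*} [NormedAddCommGroup V] [InnerProductSpace ℂ V]
    [FiniteDimensional ℂ V]
    (Qp Qm : V →ₗ[ℂ] V)
    (hQp : Qp ∘ₗ Qp = 0) (hQm : Qm ∘ₗ Qm = 0)
    (hanti : Qp ∘ₗ Qm + Qm ∘ₗ Qp = 0)
    (hadj1 : Qp ∘ₗ adjoint Qm + adjoint Qm ∘ₗ Qp = 0)
    (hadj2 : Qm ∘ₗ adjoint Qp + adjoint Qp ∘ₗ Qm = 0)
    (Δ : V →ₗ[ℂ] V)
    (hΔp : Qp ∘ₗ adjoint Qp + adjoint Qp ∘ₗ Qp = Δ)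
    (hΔm : Qm ∘ₗ adjoint Qm + adjoint Qm ∘ₗ Qm = Δ)
    (δ : ℝ) (hδ : 0 < δ)
    (x : V) (hx : x ≠ 0)
    (heig : Δ x = (δ : ℂ) • x)
    (hxp : adjoint Qp x = 0) (hxm : adjoint Qm x = 0) :
    Qp x ≠ 0 ∧ Qm x ≠ 0 ∧ Qm (Qp x) ≠ 0 ∧
      ‖Qp x‖ ^ 2 = δ * ‖x‖ ^ 2 ∧ ‖Qm x‖ ^ 2 = δ * ‖x‖ ^ 2 := by
  have ne_zero {y z : V} (hz : z ≠ 0) (h : ‖y‖ ^ 2 = δ * ‖z‖ ^ 2) : y ≠ 0 := by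
    rintro rfl
    have : 0 < δ * ‖z‖ ^ 2 := by positivity
    simp [← h] at this
  have hp := norm_sq_apply_of_adjoint_apply_eq_zero Qp hxp (hΔp ▸ heig)
  have hm := norm_sq_apply_of_adjoint_apply_eq_zero Qm hxm (hΔm ▸ heig)
  have hxm' : adjoint Qm (Qp x) = 0 := by
    simpa [hxm] using LinearMap.congr_fun hadj1 x
  have heig' : Δ (Qp x) = (δ : ℂ) • Qp x := by
    have h : adjoint Qp (Qp x) = (δ : ℂ) • x := by
      simpa [hxp, heig] using LinearMap.congr_fun hΔp x
    have h0 : Qp (Qp x) = 0 := LinearMap.congr_fun hQp x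
    simp [← hΔp, h, h0]
  have hpm := norm_sq_apply_of_adjoint_apply_eq_zero Qm hxm' (hΔm ▸ heig')
  exact ⟨ne_zero hx hp, ne_zero hx hm, ne_zero (ne_zero hx hp) hpm, hp, hm⟩
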